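/- Wellposedness of the implicit discrete obstacle problem (presupposed in Lemma 3.1 and in the implicit scheme (3.8)). For every source f : {0,...,K−1} × Ω_h → ℝ, there exists exactly one u : {0,...,K} × Ω_h → ℝ solving the implicit discrete obstacle problem with source f. -/

import Mathlib

/-- `j` is a grid point of `Ω_h = {0,…,N}^d`. -/
def isGridPt (N : ℕ) {d : ℕ} (j : Fin d → ℤ) : Prop :=
  ∀ i : Fin d, 0 ≤ j i ∧ j i ≤ (N : ℤ)

/-- `j` is an interior grid point: every coordinate lies in `{1,…,N−1}`. -/
def isInterior (N : ℕ) {d : ℕ} (j : Fin d → ℤ) : Prop :=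
  ∀ i : Fin d, 1 ≤ j i ∧ j i ≤ (N : ℤ) - 1

/-- `j` is a boundary point of the grid. -/
def isBoundary (N : ℕ) {d : ℕ} (j : Fin d → ℤ) : Prop :=
  isGridPt N j ∧ ¬ isInterior N j

/-- The finite set of interior grid points. -/
noncomputable def intPts (N d : ℕ) : Finset (Fin d → ℤ) :=
  Fintype.piFinset fun _ : Fin d => Finset.Icc (1 : ℤ) ((N : ℤ) - 1)

/-- Discrete Laplacian with mesh size `h`:
`Δ_h v (j) = h⁻² Σᵢ (v(j+eᵢ) − 2v(j) + v(j−eᵢ))`. -/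
noncomputable def discLap (h : ℝ) {d : ℕ} (v : (Fin d → ℤ) → ℝ) (j : Fin d → ℤ) : ℝ :=
  (1 / h ^ 2) * ∑ i : Fin d, (v (j + Pi.single i 1) - 2 * v j + v (j - Pi.single i 1))

/-- `u` solves the implicit discrete obstacle problem with source `f`:
`max((u^k_j − u^{k+1}_j)/τ − Δ_h u^k(j) − f^k_j, u^k_j) = 0` at interior points for `k < K`,
with `u^K = 0` on the grid and `u^k = 0` on the boundary. -/
def solvesObstacle (N K : ℕ) (τ h : ℝ) {d : ℕ}
    (f : ℕ → (Fin d → ℤ) → ℝ) (u : ℕ → (Fin d → ℤ) → ℝ) : Prop :=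
  (∀ k < K, ∀ j : Fin d → ℤ, isInterior N j →
      max ((u k j - u (k + 1) j) / τ - discLap h (u k) j - f k j) (u k j) = 0) ∧
  (∀ j : Fin d → ℤ, isGridPt N j → u K j = 0) ∧
  (∀ k < K, ∀ j : Fin d → ℤ, isBoundary N j → u k j = 0)

/-- Membership in the discrete test set `T_{h,τ}` with initial datum `m⁰`. -/
def inTestSet (N K : ℕ) (τ h : ℝ) {d : ℕ} (m0 : (Fin d → ℤ) → ℝ)
    (m : ℕ → (Fin d → ℤ) → ℝ) : Prop :=
  (∀ k ≤ K, ∀ j : Fin d → ℤ, isBoundary N j → m k j = 0) ∧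
  (∀ k ≤ K, ∀ j : Fin d → ℤ, isGridPt N j → 0 ≤ m k j) ∧
  (∀ k, 1 ≤ k → k ≤ K → ∀ j : Fin d → ℤ, isInterior N j →
      (m k j - m (k - 1) j) / τ - discLap h (m k) j ≤ 0) ∧
  (∀ j : Fin d → ℤ, isGridPt N j → m 0 j = m0 j)

theorem obs_mem_intPts (N d : ℕ) (j : Fin d → ℤ) : j ∈ intPts N d ↔ isInterior N j := by
  simp [intPts, isInterior, Fintype.mem_piFinset]

/-- Extension by zero. -/
noncomputable def obsExt (N : ℕ) {d : ℕ} (v : intPts N d → ℝ) (j : Fin d → ℤ) : ℝ :=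
  if hj : j ∈ intPts N d then v ⟨j, hj⟩ else 0

/-- Neighbour sum. -/
noncomputable def obsNb {d : ℕ} (v : (Fin d → ℤ) → ℝ) (j : Fin d → ℤ) : ℝ :=
  ∑ i : Fin d, (v (j + Pi.single i 1) + v (j - Pi.single i 1))

theorem obs_lap (h : ℝ) {d : ℕ} (v : (Fin d → ℤ) → ℝ) (j : Fin d → ℤ) :
    discLap h v j = (1 / h ^ 2) * (obsNb v j - 2 * d * v j) := by
  unfold discLap obsNb
  congr 1
  have : ∀ i : Fin d, (v (j + Pi.single i 1) - 2 * v j + v (j - Pi.single i 1))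
      = (v (j + Pi.single i 1) + v (j - Pi.single i 1)) - 2 * v j := fun i => by ring
  rw [Finset.sum_congr rfl (fun i _ => this i), Finset.sum_sub_distrib]
  simp
  ring

theorem obs_scalar (τ A D u w g S : ℝ) (hτ : 0 < τ) (hA : 0 ≤ A) (hD : 0 ≤ D) :
    max ((u - w) / τ - A * (S - D * u) - g) u = 0 ↔
      u = min 0 ((w + τ * g + τ * A * S) / (1 + τ * A * D)) := by
  have hp : 0 < 1 + τ * A * D := by positivity
  have e : (u - w) / τ - A * (S - D * u) - g
      = (1 + τ * A * D) / τ * (u - (w + τ * g + τ * A * S) / (1 + τ * A * D)) := by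
    field_simp
    ring
  rw [e]
  set q := (w + τ * g + τ * A * S) / (1 + τ * A * D)
  have hc : 0 < (1 + τ * A * D) / τ := by positivity
  set c := (1 + τ * A * D) / τ
  constructor
  · intro hm
    have h1 : c * (u - q) ≤ 0 := hm ▸ le_max_left _ _
    have h2 : u ≤ 0 := hm ▸ le_max_right _ _
    have h3 : u ≤ q := by
      by_contra hlt
      push Not at hlt
      nlinarith [mul_pos hc (sub_pos.2 hlt)]
    rcases max_choice (c * (u - q)) u with hh | hh
    · rw [hm] at hh
      have : u = q := by
        rcases mul_eq_zero.1 hh.symm with h | h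
        · exact absurd h hc.ne'
        · linarith
      rw [min_eq_right] <;> linarith
    · rw [hm] at hh
      rw [min_eq_left] <;> linarith
  · intro hu
    rcases le_total 0 q with hq | hq
    · rw [min_eq_left hq] at hu
      subst hu
      apply max_eq_right
      nlinarith [mul_nonneg hc.le hq]
    · rw [min_eq_right hq] at hu
      rw [hu]
      simp [hq]

/-- The fixed point map. -/
noncomputable def obsMap (N : ℕ) (τ h : ℝ) {d : ℕ} (w g : (Fin d → ℤ) → ℝ)
    (v : intPts N d → ℝ) (j : intPts N d) : ℝ :=
  min 0 ((w j + τ * g j + τ * (1 / h ^ 2) * obsNb (obsExt N v) j)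
    / (1 + τ * (1 / h ^ 2) * (2 * d)))

theorem obs_contr (N : ℕ) (τ h : ℝ) (hτ : 0 < τ) {d : ℕ} (w g : (Fin d → ℤ) → ℝ) :
    ∃ c, ContractingWith c (obsMap N τ h w g) := by
  have hA : 0 ≤ 1 / h ^ 2 := by positivity
  set A := 1 / h ^ 2 with hAd
  have hp : 0 < 1 + τ * A * (2 * d) := by positivity
  refine ⟨⟨τ * A * (2 * d) / (1 + τ * A * (2 * d)), by positivity⟩, ?_, ?_⟩
  · apply NNReal.coe_lt_coe.1
    show τ * A * (2 * d) / (1 + τ * A * (2 * d)) < 1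
    rw [div_lt_one hp]
    linarith
  · apply LipschitzWith.of_dist_le_mul
    intro v v'
    show dist _ _ ≤ τ * A * (2 * d) / (1 + τ * A * (2 * d)) * dist v v'
    rw [dist_pi_le_iff (by positivity)]
    intro j
    have hext : ∀ i, |obsExt N v i - obsExt N v' i| ≤ dist v v' := by
      intro i
      unfold obsExt
      split_ifs with hi
      · exact dist_le_pi_dist v v' ⟨i, hi⟩
      · simp
    have hnb : |obsNb (obsExt N v) j - obsNb (obsExt N v') j| ≤ 2 * d * dist v v' := by
      unfold obsNb
      rw [← Finset.sum_sub_distrib]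
      refine (Finset.abs_sum_le_sum_abs _ _).trans ?_
      refine (Finset.sum_le_card_nsmul _ _ (2 * dist v v') ?_).trans ?_
      · intro i _
        have h1 := hext ((j : Fin d → ℤ) + Pi.single i 1)
        have h2 := hext ((j : Fin d → ℤ) - Pi.single i 1)
        rw [abs_le] at *
        constructor <;> linarith [h1.1, h1.2, h2.1, h2.2]
      · simp
        apply le_of_eq; ring
    rw [Real.dist_eq]
    unfold obsMap
    rw [← hAd]
    refine (abs_min_sub_min_le_max _ _ _ _).trans ?_
    apply max_le
    · simp; positivity
    · rw [← sub_div, abs_div, abs_of_pos hp, div_mul_eq_mul_div]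
      gcongr
      rw [show ∀ a b x y : ℝ, a + b + τ * A * x - (a + b + τ * A * y) = τ * A * (x - y) by
        intros; ring]
      rw [abs_mul, abs_of_nonneg (by positivity : 0 ≤ τ * A)]
      calc _ ≤ τ * A * (2 * d * dist v v') := by gcongr
        _ = _ := by ring

theorem obs_nb_congr (N : ℕ) {d : ℕ} (v v' : (Fin d → ℤ) → ℝ)
    (hv : ∀ j, isGridPt N j → v j = v' j) (j : Fin d → ℤ) (hj : isInterior N j) :
    obsNb v j = obsNb v' j := by
  unfold obsNb
  refine Finset.sum_congr rfl fun i _ => ?_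
  rw [hv, hv]
  all_goals
    intro l
    have := hj l
    by_cases hl : l = i
    · subst hl
      simp
      omega
    · simp [hl]
      omega

theorem obs_interior_iff (N : ℕ) (τ h : ℝ) (hτ : 0 < τ) {d : ℕ} (w g v : (Fin d → ℤ) → ℝ)
    (j : Fin d → ℤ) : max ((v j - w j) / τ - discLap h v j - g j) (v j) = 0 ↔
      v j = min 0 ((w j + τ * g j + τ * (1 / h ^ 2) * obsNb v j)
        / (1 + τ * (1 / h ^ 2) * (2 * d))) := by
  rw [obs_lap]
  exact obs_scalar τ (1 / h ^ 2) (2 * d) _ _ _ _ hτ (by positivity) (by positivity)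

theorem obs_exists (N : ℕ) (τ h : ℝ) (hτ : 0 < τ) {d : ℕ} (w g : (Fin d → ℤ) → ℝ) :
    ∃ v : (Fin d → ℤ) → ℝ, (∀ j, isInterior N j →
      max ((v j - w j) / τ - discLap h v j - g j) (v j) = 0) ∧ ∀ j, ¬ isInterior N j → v j = 0 := by
  obtain ⟨c, hc⟩ := obs_contr N τ h hτ w g
  have hfix := hc.fixedPoint_isFixedPt
  set v := ContractingWith.fixedPoint (obsMap N τ h w g) hc
  refine ⟨obsExt N v, fun j hj => ?_, fun j hj => ?_⟩
  · rw [obs_interior_iff N τ h hτ]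
    have hm := (obs_mem_intPts N d j).2 hj
    have := congrFun hfix ⟨j, hm⟩
    conv_lhs => unfold obsExt
    rw [dif_pos hm, ← this]
    rfl
  · have hm := (obs_mem_intPts N d j).not.2 hj
    unfold obsExt
    rw [dif_neg hm]

theorem obs_fix (N : ℕ) (τ h : ℝ) (hτ : 0 < τ) {d : ℕ} (w g v : (Fin d → ℤ) → ℝ)
    (h1 : ∀ j, isInterior N j → max ((v j - w j) / τ - discLap h v j - g j) (v j) = 0)
    (h2 : ∀ j, isBoundary N j → v j = 0) :
    Function.IsFixedPt (obsMap N τ h w g) (fun j => v j) := by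
  funext j
  have hj := (obs_mem_intPts N d j).1 j.2
  have := (obs_interior_iff N τ h hτ w g v j).1 (h1 j hj)
  show _ = v j
  rw [this]
  unfold obsMap
  rw [obs_nb_congr N _ v _ j hj]
  intro i hi
  unfold obsExt
  split_ifs with hm
  · rfl
  · exact (h2 i ⟨hi, fun hc => hm ((obs_mem_intPts N d i).2 hc)⟩).symm

/-- Wellposedness of the implicit discrete obstacle problem (presupposed in Lemma 3.1 and in the
implicit scheme (3.8)): for every source `f` there exists a solution, and any two solutions agree
at every grid point `(j, k)` with `k ∈ {0,…,K}` and `j ∈ Ω_h`. -/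
theorem implicit_discrete_obstacle_problem_wellposed
    (d N K : ℕ) (hd : 1 ≤ d) (hN : 2 ≤ N) (hK : 1 ≤ K)
    (τ h : ℝ) (hτ : 0 < τ) (hh : h = 1 / (N : ℝ))
    (f : ℕ → (Fin d → ℤ) → ℝ) :
    (∃ u : ℕ → (Fin d → ℤ) → ℝ, solvesObstacle N K τ h f u) ∧
    (∀ u u' : ℕ → (Fin d → ℤ) → ℝ, solvesObstacle N K τ h f u →
      solvesObstacle N K τ h f u' →
      ∀ k ≤ K, ∀ j : Fin d → ℤ, isGridPt N j → u k j = u' k j) := by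
  constructor
  · choose S hS1 hS2 using fun w g => obs_exists N τ h hτ (d := d) w g
    let U : ℕ → (Fin d → ℤ) → ℝ := fun m => Nat.rec (fun _ => 0)
      (fun m Um => S Um (f (K - 1 - m))) m
    have hU : ∀ k < K, U (K - k) = S (U (K - (k + 1))) (f k) := by
      intro k hk
      have e1 : K - k = (K - (k + 1)) + 1 := by omega
      have e2 : K - 1 - (K - (k + 1)) = k := by omega
      rw [e1]
      show S (U (K - (k + 1))) (f (K - 1 - (K - (k + 1)))) = _
      rw [e2]
    refine ⟨fun k => U (K - k), ?_, ?_, ?_⟩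
    · intro k hk j hj
      show max ((U (K - k) j - U (K - (k + 1)) j) / τ - discLap h (U (K - k)) j - f k j)
        (U (K - k) j) = 0
      rw [hU k hk]
      exact hS1 _ _ j hj
    · intro j _
      simp [U]
    · intro k hk j hj
      show U (K - k) j = 0
      rw [hU k hk]
      exact hS2 _ _ j hj.2
  · rintro u u' ⟨a1, a2, a3⟩ ⟨b1, b2, b3⟩ k hk
    induction hk using Nat.decreasingInduction with
    | self => intro j hj; rw [a2 j hj, b2 j hj]
    | of_succ k hk ih =>
      intro j hj
      by_cases hi : isInterior N j
      · obtain ⟨c, hc⟩ := obs_contr N τ h hτ (u (k + 1)) (f k)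
        have f1 := obs_fix N τ h hτ (u (k + 1)) (f k) (u k) (a1 k hk) (a3 k hk)
        have f2 := obs_fix N τ h hτ (u (k + 1)) (f k) (u' k) (fun i hi => by
          rw [ih i (fun l => ⟨by linarith [(hi l).1], by linarith [(hi l).2]⟩)]
          exact b1 k hk i hi) (b3 k hk)
        exact congrFun (hc.fixedPoint_unique' f1 f2) ⟨j, (obs_mem_intPts N d j).2 hi⟩
      · rw [a3 k hk j ⟨hj, hi⟩, b3 k hk j ⟨hj, hi⟩]
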